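/- Let ε > 0, and let δ > 0 be such that for every house-free graph G with |V(G)| > 1, either there are disjoint sets A, B ⊆ V(G), complete to each other, with |A|, |B| ≥ εδ|V(G)|, or there exists X ⊆ V(G) with |X| ≥ δ|V(G)| such that G[X] has maximum degree less than ε|X|. Let α ≥ 1 with εδ2^α > 1, and let (G, f) be an α-critical pair where G is house-free. Then there is a subset X ⊆ V(G) and a good function g on G[X] with g(v) ≤ f(v) for each v ∈ X, such that Σ_{v∈X} (g(v))^α ≥ δ · Σ_{v∈V(G)} (f(v))^α, and Σ_{u∈N_G(v)∩X} (g(u))^α < ε · Σ_{v∈X} (g(v))^α for every vertex v ∈ X. -/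

import Mathlib

open Finset

namespace EHhat

variable {V : Type*}

/-- `c : ZMod n → V` describes a hole (induced cycle of length `n ≥ 4`) in `G`. -/
def IsHole (G : SimpleGraph V) (n : ℕ) (c : ZMod n → V) : Prop :=
  4 ≤ n ∧ Function.Injective c ∧
    ∀ i j : ZMod n, G.Adj (c i) (c j) ↔ (i - j = 1 ∨ j - i = 1)

/-- `G` contains a hole together with a hat: a vertex outside the hole with exactly
two neighbours on the hole, and these two neighbours are adjacent (consecutive). -/
def HasHoleWithHat (G : SimpleGraph V) : Prop :=
  ∃ (n : ℕ) (c : ZMod n → V) (v : V) (i : ZMod n),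
    IsHole G n c ∧ (∀ j, v ≠ c j) ∧ (∀ j, G.Adj v (c j) ↔ (j = i ∨ j = i + 1))

def HoleWithHatFree (G : SimpleGraph V) : Prop := ¬ HasHoleWithHat G

/-- A graph is perfect if chromatic number equals clique number for
every induced subgraph. -/
def IsPerfect [Fintype V] (G : SimpleGraph V) : Prop :=
  ∀ S : Finset V,
    (G.induce (S : Set V)).chromaticNumber = ((G.induce (S : Set V)).cliqueNum : ℕ∞)

/-- `f` is a good function on `G`: it is nonnegative and sums to at most 1 on
every perfect induced subgraph of `G`. -/
def GoodOn [Fintype V] (G : SimpleGraph V) (f : V → ℝ) : Prop :=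
  (∀ v, 0 ≤ f v) ∧
  ∀ S : Finset V, IsPerfect (G.induce (S : Set V)) → ∑ v ∈ S, f v ≤ 1

/-- `G` is `α`-narrow if `∑ v, f v ^ α ≤ 1` for every good function `f` on `G`. -/
def Narrow [Fintype V] (G : SimpleGraph V) (α : ℝ) : Prop :=
  ∀ f : V → ℝ, GoodOn G f → ∑ v, f v ^ α ≤ 1

/-- `(G, f)` is an `α`-critical pair. -/
def Critical [Fintype V] (G : SimpleGraph V) (f : V → ℝ) (α : ℝ) : Prop :=
  GoodOn G f ∧
  (∀ S : Finset V, S ≠ Finset.univ → Narrow (G.induce (S : Set V)) α) ∧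
  1 < ∑ v, f v ^ α

/-- `A` is complete to `B`. -/
def CompleteTo (G : SimpleGraph V) (A B : Set V) : Prop :=
  ∀ a ∈ A, ∀ b ∈ B, G.Adj a b

/-- `A` is anticomplete to `B`. -/
def AnticompleteTo (G : SimpleGraph V) (A B : Set V) : Prop :=
  ∀ a ∈ A, ∀ b ∈ B, ¬ G.Adj a b

/-- The vertex `v` is complete to the set `C`. -/
def VertCompleteTo (G : SimpleGraph V) (v : V) (C : Set V) : Prop :=
  ∀ c ∈ C, G.Adj v c

/-- The vertex `v` is mixed on `C`: it has both a neighbour and a non-neighbour in `C`. -/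
def MixedOn (G : SimpleGraph V) (v : V) (C : Set V) : Prop :=
  (∃ c ∈ C, G.Adj v c) ∧ (∃ c ∈ C, ¬ G.Adj v c)

/-- `X ⊆ V(G)` is connected: `G[X]` is a connected graph. -/
def ConnSet (G : SimpleGraph V) (X : Set V) : Prop :=
  (G.induce X).Connected

/-- `X ⊆ V(G)` is anticonnected: the complement of `G[X]` is a connected graph. -/
def AnticonnSet (G : SimpleGraph V) (X : Set V) : Prop :=
  ((G.induce X)ᶜ).Connected

/-- The sum of `f` over a set `X` of vertices. -/
noncomputable def setSum [Fintype V] (f : V → ℝ) (X : Set V) : ℝ :=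
  ∑ v, X.indicator f v

/-- `w` is a weight function making `(G, w)` a weighted graph. -/
def IsWeight [Fintype V] (w : V → ℝ) : Prop :=
  (∀ v, 0 ≤ w v) ∧ ∑ v, w v = 1

/-- The weighted graph `(G, w)` is `ε`-coherent. -/
def Coherent [Fintype V] (G : SimpleGraph V) (w : V → ℝ) (ε : ℝ) : Prop :=
  (∀ v, w v < ε) ∧
  (∀ v, setSum w (G.neighborSet v) < ε) ∧
  ∀ A B : Set V, Disjoint A B → AnticompleteTo G A B →
    min (setSum w A) (setSum w B) < ε

/-- `Y` is (the vertex set of) a component of `G[X]`: a maximal connected subset of `X`. -/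
def IsCompOf (G : SimpleGraph V) (X Y : Set V) : Prop :=
  Y ⊆ X ∧ ConnSet G Y ∧
  ∀ Z : Set V, Y ⊆ Z → Z ⊆ X → ConnSet G Z → Z = Y

/-- `Y` is the big component of `G[X]` (with respect to the weight `w` and `ε`). -/
def IsBigComp [Fintype V] (G : SimpleGraph V) (w : V → ℝ) (ε : ℝ) (X Y : Set V) : Prop :=
  IsCompOf G X Y ∧ setSum w X - ε < setSum w Y

/-- `v` is an attachment of `A`: a vertex outside `A` with a neighbour in `A`. -/
def IsAttachment (G : SimpleGraph V) (A : Set V) (v : V) : Prop :=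
  v ∉ A ∧ ∃ a ∈ A, G.Adj v a

/-- `(C, D)` is a split of the weighted graph `(G, w)`. -/
def IsSplit [Fintype V] (G : SimpleGraph V) (w : V → ℝ) (ε : ℝ) (C D : Set V) : Prop :=
  Disjoint C D ∧ 2 ≤ C.ncard ∧ ConnSet G C ∧ AnticonnSet G C ∧
  D.Nonempty ∧ D = {v | v ∉ C ∧ ∀ c ∈ C, G.Adj v c} ∧
  ∀ Y : Set V, IsBigComp G w ε ((C ∪ D)ᶜ) Y → ∀ c ∈ C, ¬ IsAttachment G Y c

/-- A split is optimal if its first part is maximal among splits. -/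
def IsOptimalSplit [Fintype V] (G : SimpleGraph V) (w : V → ℝ) (ε : ℝ) (C D : Set V) : Prop :=
  IsSplit G w ε C D ∧ ∀ C' D' : Set V, IsSplit G w ε C' D' → C ⊆ C' → C' = C

/-- `(A, C, D, B)` is a fracture of `(G, w)`: `(C, D)` is an optimal split, `A` is the union
of the components of `G \ (C ∪ D)` with an attachment in `C`, and `B` is the rest. -/
def IsFracture [Fintype V] (G : SimpleGraph V) (w : V → ℝ) (ε : ℝ)
    (A C D B : Set V) : Prop :=
  IsOptimalSplit G w ε C D ∧
  A = {v | ∃ Y : Set V, IsCompOf G ((C ∪ D)ᶜ) Y ∧ v ∈ Y ∧ ∃ c ∈ C, IsAttachment G Y c} ∧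
  B = ((C ∪ D)ᶜ : Set V) \ A

/-- The generating relation for the forcer graph: vertices `0,1,2,3` and `4,5,6,7`
each induce a path, and the two quadruples are complete to each other. -/
def forcerRel (i j : Fin 8) : Prop :=
  (i.val < 4 ∧ 4 ≤ j.val) ∨ j.val = i.val + 1

/-- The forcer graph. -/
def forcer : SimpleGraph (Fin 8) := SimpleGraph.fromRel forcerRel

def ForcerFree (G : SimpleGraph V) : Prop := IsEmpty (forcer ↪g G)

/-- Given an embedded copy of the forcer via the vertex map `f`, one of its two
constituent paths has all its vertices in `S`. -/
def ConstituentPathIn (f : Fin 8 → V) (S : Set V) : Prop :=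
  (∀ i : Fin 8, i.val < 4 → f i ∈ S) ∨ (∀ i : Fin 8, 4 ≤ i.val → f i ∈ S)

/-- `X` is a homogeneous set of `H`. -/
def IsHomogeneousSet {W : Type*} (H : SimpleGraph W) (X : Set W) : Prop :=
  ∀ v ∉ X, (∀ x ∈ X, H.Adj v x) ∨ (∀ x ∈ X, ¬ H.Adj v x)

/-- `H` is guarded: for each forcer in `H` there is a proper homogeneous set
containing a constituent path of the forcer. -/
def Guarded {W : Type*} (H : SimpleGraph W) : Prop :=
  ∀ f : forcer ↪g H, ∃ X : Set W,
    X ≠ Set.univ ∧ IsHomogeneousSet H X ∧ ConstituentPathIn (fun i => f i) X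

/-- The house: the complement of the five-vertex path. -/
def house : SimpleGraph (Fin 5) := (SimpleGraph.pathGraph 5)ᶜ

def HouseFree (G : SimpleGraph V) : Prop := IsEmpty (house ↪g G)

/-- `g` is a good function on the induced subgraph `G[X]`. -/
def GoodOnSub [Fintype V] (G : SimpleGraph V) (X : Set V) (g : V → ℝ) : Prop :=
  (∀ v ∈ X, 0 ≤ g v) ∧
  ∀ S : Finset V, (S : Set V) ⊆ X → IsPerfect (G.induce (S : Set V)) →
    ∑ v ∈ S, g v ≤ 1

section Perfect

variable {W : Type*}

/-- Every subset `Q` of `S` contains a clique `k` such that `G[Q]` is `#k`-colourable. -/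
def PerfectOn (G : SimpleGraph V) (S : Finset V) : Prop :=
  ∀ Q ⊆ S, ∃ k ⊆ Q, G.IsClique (k : Set V) ∧
    ∃ c : V → ℕ, (∀ v ∈ Q, c v < #k) ∧ ∀ u ∈ Q, ∀ v ∈ Q, G.Adj u v → c u ≠ c v

lemma chromaticNumber_eq_cliqueNum_induce_iff (G : SimpleGraph V) (Q : Finset V) :
    (G.induce (Q : Set V)).chromaticNumber = ((G.induce (Q : Set V)).cliqueNum : ℕ∞) ↔
      ∃ k ⊆ Q, G.IsClique (k : Set V) ∧
        ∃ c : V → ℕ, (∀ v ∈ Q, c v < #k) ∧ ∀ u ∈ Q, ∀ v ∈ Q, G.Adj u v → c u ≠ c v := by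
  classical
  constructor
  · intro h
    obtain ⟨s, hs⟩ := (G.induce (Q : Set V)).exists_isNClique_cliqueNum
    have hcol := SimpleGraph.chromaticNumber_le_iff_colorable.1 h.le
    obtain ⟨C, hC⟩ := (SimpleGraph.colorable_iff_exists_bdd_nat_coloring _).1 hcol
    refine ⟨s.map (Function.Embedding.subtype _), ?_, ?_,
      fun v => if hv : v ∈ (Q : Set V) then C ⟨v, hv⟩ else 0, ?_, ?_⟩
    · intro v hv
      obtain ⟨w, -, rfl⟩ := Finset.mem_map.1 hv
      exact w.2
    · intro a ha b hb hab
      obtain ⟨a', ha', rfl⟩ := Finset.mem_map.1 ha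
      obtain ⟨b', hb', rfl⟩ := Finset.mem_map.1 hb
      exact hs.isClique ha' hb' fun h => hab (by rw [h])
    · intro v hv
      have hv' : v ∈ (Q : Set V) := hv
      simpa [hv', hs.card_eq] using hC ⟨v, hv⟩
    · intro u hu v hv huv
      have hu' : u ∈ (Q : Set V) := hu
      have hv' : v ∈ (Q : Set V) := hv
      simp only [hu', hv', dif_pos]
      exact C.valid (show (G.induce (Q : Set V)).Adj ⟨u, hu'⟩ ⟨v, hv'⟩ from huv)
  · rintro ⟨k, hkQ, hk, c, hc, hcol⟩
    refine le_antisymm ?_ SimpleGraph.cliqueNum_le_chromaticNumber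
    have hcolor : (G.induce (Q : Set V)).Colorable #k :=
      (SimpleGraph.colorable_iff_exists_bdd_nat_coloring _).2
        ⟨SimpleGraph.Coloring.mk (fun v => c v) fun {u v} huv => hcol u u.2 v v.2 huv,
          fun v => hc v v.2⟩
    refine hcolor.chromaticNumber_le.trans ?_
    have hclique : (G.induce (Q : Set V)).IsClique
        ((k.subtype (· ∈ (Q : Set V)) : Finset (Q : Set V)) : Set (Q : Set V)) := by
      intro a ha b hb hab
      exact hk (by simpa using ha) (by simpa using hb) fun h => hab (Subtype.ext h)
    have hcard := hclique.card_le_cliqueNum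
    rw [Finset.card_subtype, Finset.filter_true_of_mem (p := (· ∈ (Q : Set V))) fun x hx => hkQ hx]
      at hcard
    exact_mod_cast hcard

lemma isPerfect_iff_perfectOn_univ [Fintype V] (G : SimpleGraph V) :
    IsPerfect G ↔ PerfectOn G univ := by
  simp only [IsPerfect, PerfectOn, chromaticNumber_eq_cliqueNum_induce_iff, Finset.subset_univ,
    forall_const]

lemma perfectOn_map_iff {G : SimpleGraph V} {H : SimpleGraph W} (e : G ↪g H) (P : Finset V) :
    PerfectOn H (P.map e.toEmbedding) ↔ PerfectOn G P := by
  classical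
  constructor
  · intro h Q hQ
    obtain ⟨k, hk, hclique, c, hc, hcol⟩ := h (Q.map e.toEmbedding) (Finset.map_subset_map.2 hQ)
    obtain ⟨k, hk', rfl⟩ := Finset.subset_map_iff.1 hk
    refine ⟨k, hk', ?_, c ∘ e, ?_, ?_⟩
    · intro a ha b hb hab
      exact e.map_adj_iff.1 (hclique (by simpa using ha) (by simpa using hb)
        fun h => hab (e.injective h))
    · intro v hv
      simpa using hc (e v) (by simpa using hv)
    · intro u hu v hv huv
      exact hcol _ (by simpa using hu) _ (by simpa using hv) (e.map_adj_iff.2 huv)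
  · intro h Q hQ
    obtain ⟨Q, hQ', rfl⟩ := Finset.subset_map_iff.1 hQ
    obtain ⟨k, hk, hclique, c, hc, hcol⟩ := h Q hQ'
    refine ⟨k.map e.toEmbedding, Finset.map_subset_map.2 hk, ?_, Function.extend e c 0, ?_, ?_⟩
    · intro a ha b hb hab
      obtain ⟨a, ha', rfl⟩ := Finset.mem_map.1 ha
      obtain ⟨b, hb', rfl⟩ := Finset.mem_map.1 hb
      exact e.map_adj_iff.2 (hclique ha' hb' fun h => hab (by rw [h]))
    · intro v hv
      obtain ⟨v, hv', rfl⟩ := Finset.mem_map.1 hv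
      simpa [e.injective.extend_apply] using hc v hv'
    · intro u hu v hv huv
      obtain ⟨u, hu', rfl⟩ := Finset.mem_map.1 hu
      obtain ⟨v, hv', rfl⟩ := Finset.mem_map.1 hv
      simpa [e.injective.extend_apply] using hcol u hu' v hv' (e.map_adj_iff.1 huv)

lemma isPerfect_induce_iff (G : SimpleGraph V) (S : Finset V) [Fintype (S : Set V)] :
    IsPerfect (G.induce (S : Set V)) ↔ PerfectOn G S := by
  rw [isPerfect_iff_perfectOn_univ, ← perfectOn_map_iff (SimpleGraph.Embedding.induce (S : Set V))]
  have h : (univ : Finset (S : Set V)).map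
      (SimpleGraph.Embedding.induce (G := G) (S : Set V)).toEmbedding = S := by
    ext v
    simp
  rw [h]

lemma perfectOn_union_of_completeTo [DecidableEq V] {G : SimpleGraph V} {S T : Finset V}
    (hS : PerfectOn G S) (hT : PerfectOn G T) (hdisj : Disjoint S T)
    (hcomp : CompleteTo G (S : Set V) (T : Set V)) : PerfectOn G (S ∪ T) := by
  intro Q hQ
  obtain ⟨k, hk, hkc, c, hc, hcol⟩ := hS (Q ∩ S) Finset.inter_subset_right
  obtain ⟨l, hl, hlc, d, hd, hdol⟩ := hT (Q ∩ T) Finset.inter_subset_right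
  have hkS : k ⊆ S := hk.trans Finset.inter_subset_right
  have hlT : l ⊆ T := hl.trans Finset.inter_subset_right
  have hcard : #(k ∪ l) = #k + #l :=
    Finset.card_union_of_disjoint (Finset.disjoint_of_subset_left hkS
      (Finset.disjoint_of_subset_right hlT hdisj))
  refine ⟨k ∪ l, Finset.union_subset (hk.trans Finset.inter_subset_left)
    (hl.trans Finset.inter_subset_left), ?_, fun v => if v ∈ S then c v else #k + d v, ?_, ?_⟩
  · intro a ha b hb hab
    rcases Finset.mem_union.1 ha with ha | ha <;> rcases Finset.mem_union.1 hb with hb | hb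
    · exact hkc ha hb hab
    · exact hcomp a (hkS ha) b (hlT hb)
    · exact (hcomp b (hkS hb) a (hlT ha)).symm
    · exact hlc ha hb hab
  · intro v hv
    rw [hcard]
    have := hc v
    have := hd v
    have := Finset.mem_union.1 (hQ hv)
    simp only [Finset.mem_inter] at *
    split_ifs <;> grind
  · intro u hu v hv huv
    have := hc u
    have := hc v
    have := hcol u
    have := hdol u
    have := Finset.mem_union.1 (hQ hv)
    have := Finset.mem_union.1 (hQ hu)
    simp only [Finset.mem_inter] at *
    grind

end Perfect

section Good

lemma GoodOn.sum_le_one [Fintype V] {G : SimpleGraph V} {f : V → ℝ} (hf : GoodOn G f)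
    {S : Finset V} (hS : PerfectOn G S) : ∑ v ∈ S, f v ≤ 1 :=
  hf.2 S ((isPerfect_induce_iff G S).2 hS)

lemma two_rpow_mul_sum_le_one [Fintype V] {G : SimpleGraph V} {f : V → ℝ} {α : ℝ}
    (hf : ∀ v, 0 ≤ f v) {A : Finset V} (hA : Narrow (G.induce (A : Set V)) α)
    (hhalf : ∀ P ⊆ A, PerfectOn G P → ∑ v ∈ P, f v ≤ 1 / 2) :
    (2 : ℝ) ^ α * ∑ v ∈ A, f v ^ α ≤ 1 := by
  have h := hA (fun v => 2 * f v) ⟨fun v => by have := hf v; positivity, ?_⟩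
  · have hsum : ∑ v : (A : Set V), (2 * f v) ^ α = ∑ v ∈ A, (2 * f v) ^ α :=
      Finset.sum_coe_sort A fun v => (2 * f v) ^ α
    rw [hsum] at h
    rw [Finset.mul_sum]
    refine le_of_eq_of_le (Finset.sum_congr rfl fun v _ => ?_) h
    rw [Real.mul_rpow (by norm_num) (hf v)]
  · intro S hS
    rw [isPerfect_induce_iff, ← perfectOn_map_iff (SimpleGraph.Embedding.induce (A : Set V))] at hS
    have := hhalf _ ?_ hS
    · rw [Finset.sum_map] at this
      rw [← Finset.mul_sum]
      simp only [SimpleGraph.Embedding.induce, RelEmbedding.coe_toEmbedding] at this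
      change ∑ v ∈ S, f v ≤ 1 / 2 at this
      linarith
    · intro v hv
      obtain ⟨w, -, rfl⟩ := Finset.mem_map.1 hv
      exact w.2

lemma Critical.min_sum_le [Fintype V] {G : SimpleGraph V} {f : V → ℝ} {α : ℝ}
    (h : Critical G f α) {A B : Finset V} (hdisj : Disjoint A B)
    (hcomp : CompleteTo G (A : Set V) (B : Set V)) :
    (2 : ℝ) ^ α * ∑ v ∈ A, f v ^ α ≤ 1 ∨ (2 : ℝ) ^ α * ∑ v ∈ B, f v ^ α ≤ 1 := by
  classical
  obtain ⟨hgood, hnarrow, -⟩ := h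
  by_cases hA : A = univ
  · right
    have : B = ∅ := by
      subst hA
      exact Finset.eq_empty_of_forall_notMem fun v hv =>
        Finset.disjoint_left.1 hdisj (Finset.mem_univ v) hv
    simp [this]
  by_cases hB : B = univ
  · left
    have : A = ∅ := by
      subst hB
      exact Finset.eq_empty_of_forall_notMem fun v hv =>
        Finset.disjoint_left.1 hdisj hv (Finset.mem_univ v)
    simp [this]
  by_cases hhalf : ∀ P ⊆ A, PerfectOn G P → ∑ v ∈ P, f v ≤ 1 / 2
  · exact Or.inl (two_rpow_mul_sum_le_one hgood.1 (hnarrow A hA) hhalf)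
  · push Not at hhalf
    obtain ⟨P, hPA, hP, hPsum⟩ := hhalf
    refine Or.inr (two_rpow_mul_sum_le_one hgood.1 (hnarrow B hB) fun Q hQB hQ => ?_)
    have hPQ : Disjoint P Q :=
      Finset.disjoint_of_subset_left hPA (Finset.disjoint_of_subset_right hQB hdisj)
    have hsum := hgood.sum_le_one
      (perfectOn_union_of_completeTo hP hQ hPQ fun a ha b hb => hcomp a (hPA ha) b (hQB hb))
    rw [Finset.sum_union hPQ] at hsum
    linarith

end Good

section Blowup

/-- The graph obtained from `G` by substituting for each vertex `v` the disjoint union of `K`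
cliques of size `n v`. -/
def blowup (G : SimpleGraph V) (n : V → ℕ) (K : ℕ) :
    SimpleGraph (Σ v, Fin (n v) × Fin K) where
  Adj p q := G.Adj p.1 q.1 ∨ (p.1 = q.1 ∧ p.2.2 = q.2.2 ∧ p ≠ q)
  symm := ⟨fun _ _ h => h.imp SimpleGraph.Adj.symm fun h => ⟨h.1.symm, h.2.1.symm, h.2.2.symm⟩⟩
  loopless := ⟨fun _ h => h.elim (SimpleGraph.irrefl G) fun h => h.2.2 rfl⟩

lemma house_adj (i j : Fin 5) : house.Adj i j ↔ i.val + 2 ≤ j.val ∨ j.val + 2 ≤ i.val := by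
  simp only [house, SimpleGraph.compl_adj, SimpleGraph.pathGraph_adj, ne_eq, Fin.ext_iff]
  omega

/-- The house has no homogeneous set of size between two and four. -/
lemma house_fiber_eq {P : Fin 5 → V}
    (hP : ∀ i j k, P i = P j → house.Adj k i → ¬ house.Adj k j → P k = P i)
    {i j : Fin 5} (hij : i ≠ j) (h : P i = P j) : P 0 = P 1 ∧ P 0 = P 3 := by
  simp only [house_adj] at hP
  have h1 := hP 2 1 0
  have h2 := hP 3 1 0
  have h3 := hP 4 1 0
  have h4 := hP 3 0 1
  have h5 := hP 4 0 1
  have h6 := hP 3 2 1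
  have h7 := hP 4 2 1
  have h8 := hP 0 1 2
  have h9 := hP 4 1 2
  have h10 := hP 0 3 2
  have h11 := hP 4 3 2
  have h12 := hP 0 2 3
  have h13 := hP 1 2 3
  have h14 := hP 0 4 3
  have h15 := hP 1 4 3
  have h16 := hP 0 3 4
  have h17 := hP 1 3 4
  have h18 := hP 2 3 4
  clear hP
  norm_num at *
  fin_cases i <;> fin_cases j <;> simp at h hij <;> grind

lemma HouseFree.blowup {G : SimpleGraph V} (hG : HouseFree G) (n : V → ℕ) (K : ℕ) :
    HouseFree (blowup G n K) := by
  refine ⟨fun e => ?_⟩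
  have hadj : ∀ i j, house.Adj i j ↔ G.Adj (e i).1 (e j).1 ∨
      ((e i).1 = (e j).1 ∧ (e i).2.2 = (e j).2.2 ∧ e i ≠ e j) := fun i j => e.map_adj_iff.symm
  by_cases hinj : ∀ i j, (e i).1 = (e j).1 → i = j
  · refine hG.false ⟨⟨fun i => (e i).1, fun i j => hinj i j⟩, fun {i j} => ?_⟩
    rw [hadj]
    refine ⟨Or.inl, fun h => h.resolve_right fun h => h.2.2 (by rw [hinj i j h.1])⟩
  · push Not at hinj
    obtain ⟨i, j, h, hij⟩ := hinj
    obtain ⟨h01, h03⟩ := house_fiber_eq (P := fun i => (e i).1) (fun i j k h hi hj => by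
      by_contra hne
      refine hj ((hadj k j).2 (Or.inl ?_))
      rw [← h]
      exact ((hadj k i).1 hi).resolve_right fun h => hne h.1) hij h
    have a03 := (hadj 0 3).1 ((house_adj 0 3).2 (by simp))
    have a13 := (hadj 1 3).1 ((house_adj 1 3).2 (by simp))
    have a01 : ¬ house.Adj 0 1 := by simp [house_adj]
    refine a01 ((hadj 0 1).2 (Or.inr ⟨h01, ?_, fun h => ?_⟩))
    · exact (a03.resolve_left fun h => h.ne h03).2.1.trans
        (a13.resolve_left fun h => h.ne (h01.symm.trans h03)).2.1.symm
    · exact absurd (e.injective h) (by decide)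

variable [DecidableEq V] {G : SimpleGraph V} {n : V → ℕ} {K : ℕ}

lemma card_filter_fst_le (A : Finset (Σ v, Fin (n v) × Fin K)) (v : V) :
    #{a ∈ A | a.1 = v} ≤ n v * K := by
  calc #{a ∈ A | a.1 = v} ≤ #(range (n v) ×ˢ (univ : Finset (Fin K))) := by
        refine Finset.card_le_card_of_injOn (fun a => (a.2.1.val, a.2.2)) ?_ ?_
        · rintro ⟨u, i, k⟩ ha
          obtain ⟨-, rfl⟩ := Finset.mem_filter.1 ha
          simp
        · rintro ⟨u, i, k⟩ ha ⟨w, j, l⟩ hb hab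
          obtain ⟨-, rfl⟩ := Finset.mem_filter.1 ha
          obtain ⟨-, hw⟩ := Finset.mem_filter.1 hb
          obtain rfl : w = u := hw
          simpa [Fin.ext_iff] using hab
    _ = n v * K := by simp

lemma card_filter_fst_le_of_snd (A : Finset (Σ v, Fin (n v) × Fin K)) (v : V) (k : Fin K)
    (hk : ∀ a ∈ A, a.1 = v → a.2.2 = k) : #{a ∈ A | a.1 = v} ≤ n v := by
  calc #{a ∈ A | a.1 = v} ≤ #(range (n v)) := by
        refine Finset.card_le_card_of_injOn (fun a => a.2.1.val) ?_ ?_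
        · rintro ⟨u, i, k⟩ ha
          obtain ⟨-, rfl⟩ := Finset.mem_filter.1 ha
          simp
        · rintro ⟨u, i, l⟩ ha ⟨w, j, m⟩ hb hab
          have hl := hk _ (Finset.mem_filter.1 ha).1 (Finset.mem_filter.1 ha).2
          have hm := hk _ (Finset.mem_filter.1 hb).1 (Finset.mem_filter.1 hb).2
          obtain ⟨-, rfl⟩ := Finset.mem_filter.1 ha
          obtain ⟨-, hw⟩ := Finset.mem_filter.1 hb
          obtain rfl : w = u := hw
          simp only at hl hm
          subst hl
          subst hm
          simpa [Fin.ext_iff] using hab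
    _ = n v := by simp

lemma completeTo_sdiff_image_fst {A B : Finset (Σ v, Fin (n v) × Fin K)}
    (h : CompleteTo (blowup G n K) (A : Set _) (B : Set _)) :
    CompleteTo G (A.image Sigma.fst \ B.image Sigma.fst : Finset V)
      (B.image Sigma.fst \ A.image Sigma.fst : Finset V) := by
  intro u hu v hv
  obtain ⟨hu1, hu2⟩ := Finset.mem_sdiff.1 hu
  obtain ⟨hv1, hv2⟩ := Finset.mem_sdiff.1 hv
  obtain ⟨a, ha, rfl⟩ := Finset.mem_image.1 hu1
  obtain ⟨b, hb, rfl⟩ := Finset.mem_image.1 hv1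
  refine (h a ha b hb).resolve_right fun hab => hu2 ?_
  rw [hab.1]
  exact hv1

variable [Fintype V]

lemma card_eq_sum_card_filter_fst (A : Finset (Σ v, Fin (n v) × Fin K)) :
    #A = ∑ v, #{a ∈ A | a.1 = v} :=
  Finset.card_eq_sum_card_fiberwise fun _ _ => Finset.mem_coe.2 (Finset.mem_univ _)

lemma card_le_of_completeTo_blowup {A B : Finset (Σ v, Fin (n v) × Fin K)}
    (h : CompleteTo (blowup G n K) (A : Set _) (B : Set _)) :
    #A ≤ (∑ v ∈ A.image Sigma.fst \ B.image Sigma.fst, n v) * K + ∑ v, n v := by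
  rw [card_eq_sum_card_filter_fst, Finset.sum_mul, ← Finset.sum_filter_add_sum_filter_not univ
    (· ∈ A.image Sigma.fst \ B.image Sigma.fst), Finset.filter_univ_mem]
  refine add_le_add (Finset.sum_le_sum fun v _ => card_filter_fst_le A v) ?_
  refine le_trans (Finset.sum_le_sum fun v hv => ?_)
    (Finset.sum_le_sum_of_subset (Finset.filter_subset _ _))
  simp only [Finset.mem_filter, Finset.mem_univ, true_and, Finset.mem_sdiff, not_and, not_not] at hv
  by_cases hA : v ∈ A.image Sigma.fst
  · obtain ⟨b, hb, rfl⟩ := Finset.mem_image.1 (hv hA)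
    refine card_filter_fst_le_of_snd A _ b.2.2 fun a ha hab => ?_
    rcases h a ha b hb with hadj | hadj
    · rw [hab] at hadj
      exact (SimpleGraph.irrefl G hadj).elim
    · exact hadj.2.1
  · rw [Finset.filter_false_of_mem fun a ha hav => hA (Finset.mem_image.2 ⟨a, ha, hav⟩)]
    simp

open Classical in
lemma exists_mul_sum_le_degree {S : Finset (Σ v, Fin (n v) × Fin K)} {v : V}
    (hv : 0 < #{a ∈ S | a.1 = v}) :
    ∃ w ∈ S, K * ∑ u with G.Adj v u, #{a ∈ S | a.1 = u} + #{a ∈ S | a.1 = v} ≤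
      K * (#{a ∈ S | (blowup G n K).Adj w a} + 1) := by
  obtain ⟨⟨v₀, i₀, k₀⟩, -⟩ := Finset.card_pos.1 hv
  have hsum : #{a ∈ S | a.1 = v} = ∑ k : Fin K, #{a ∈ {a ∈ S | a.1 = v} | a.2.2 = k} :=
    Finset.card_eq_sum_card_fiberwise fun _ _ => Finset.mem_coe.2 (Finset.mem_univ _)
  obtain ⟨k, -, hk⟩ := Finset.exists_le_of_sum_le (s := (univ : Finset (Fin K)))
    (f := fun _ => #{a ∈ S | a.1 = v}) (g := fun k => K * #{a ∈ {a ∈ S | a.1 = v} | a.2.2 = k})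
    ⟨k₀, Finset.mem_univ _⟩ (by rw [← Finset.mul_sum, ← hsum]; simp)
  have hpos : 0 < #{a ∈ {a ∈ S | a.1 = v} | a.2.2 = k} := by
    by_contra h0
    have h0 : #{a ∈ {a ∈ S | a.1 = v} | a.2.2 = k} = 0 := by omega
    rw [h0] at hk
    omega
  obtain ⟨w, hw⟩ := Finset.card_pos.1 hpos
  have hw' : (w ∈ S ∧ w.1 = v) ∧ w.2.2 = k := by simpa using hw
  refine ⟨w, hw'.1.1, ?_⟩
  have hnbr : #{a ∈ S | G.Adj v a.1} = ∑ u with G.Adj v u, #{a ∈ S | a.1 = u} := by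
    rw [Finset.card_eq_sum_card_fiberwise (f := Sigma.fst) (t := {u | G.Adj v u})
      fun a ha => by simpa using (Finset.mem_filter.1 ha).2]
    refine Finset.sum_congr rfl fun u hu => ?_
    rw [Finset.filter_filter]
    congr 1
    ext a
    simp only [Finset.mem_filter, Finset.mem_univ, true_and] at hu ⊢
    grind
  have hdisj : Disjoint ({a ∈ S | G.Adj v a.1} : Finset _)
      ({a ∈ {a ∈ S | a.1 = v} | a.2.2 = k}.erase w) := by
    rw [Finset.disjoint_left]
    intro a ha hb
    simp only [Finset.mem_filter, Finset.mem_erase] at ha hb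
    rw [hb.2.1.2] at ha
    exact SimpleGraph.irrefl G ha.2
  have hsub : ({a ∈ S | G.Adj v a.1} : Finset _) ∪ {a ∈ {a ∈ S | a.1 = v} | a.2.2 = k}.erase w ⊆
      {a ∈ S | (blowup G n K).Adj w a} := by
    intro a ha
    simp only [Finset.mem_filter, Finset.mem_erase, Finset.mem_union] at ha ⊢
    rcases ha with ha | ha
    · exact ⟨ha.1, Or.inl (hw'.1.2 ▸ ha.2)⟩
    · exact ⟨ha.2.1.1, Or.inr ⟨hw'.1.2.trans ha.2.1.2.symm, hw'.2.trans ha.2.2.symm, ha.1.symm⟩⟩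
  have hcard := Finset.card_le_card hsub
  rw [Finset.card_union_of_disjoint hdisj, hnbr, Finset.card_erase_of_mem hw] at hcard
  calc _ ≤ K * ∑ u with G.Adj v u, #{a ∈ S | a.1 = u} +
        K * #{a ∈ {a ∈ S | a.1 = v} | a.2.2 = k} := by gcongr
    _ = K * (∑ u with G.Adj v u, #{a ∈ S | a.1 = u} + #{a ∈ {a ∈ S | a.1 = v} | a.2.2 = k}) := by
        ring
    _ ≤ _ := Nat.mul_le_mul_left _ (by omega)

end Blowup

section Weight

open Filter Topology Classical

lemma card_cast_le_of_completeTo_blowup [Fintype V] {G : SimpleGraph V} {K N : ℕ} (hK : 0 < K)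
    (hN : 0 < N) {x : V → ℝ} (hx : ∀ v, 0 ≤ x v)
    {A B : Finset (Σ v, Fin ⌊N * x v⌋₊ × Fin K)}
    (h : CompleteTo (blowup G (fun v => ⌊N * x v⌋₊) K) (A : Set _) (B : Set _)) :
    (#A : ℝ) ≤ N * K * (∑ v ∈ A.image Sigma.fst \ B.image Sigma.fst, x v + (∑ v, x v) / K) := by
  have hfloor : ∀ v, (⌊N * x v⌋₊ : ℝ) ≤ N * x v := fun v =>
    Nat.floor_le (mul_nonneg N.cast_nonneg (hx v))
  have hA : (#A : ℝ) ≤ (∑ v ∈ A.image Sigma.fst \ B.image Sigma.fst, (⌊N * x v⌋₊ : ℝ)) * K +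
      ∑ v, (⌊N * x v⌋₊ : ℝ) := by
    exact_mod_cast card_le_of_completeTo_blowup h
  refine hA.trans ?_
  calc _ ≤ (∑ v ∈ A.image Sigma.fst \ B.image Sigma.fst, N * x v) * K + ∑ v, N * x v := by
        gcongr <;> exact hfloor _
    _ = _ := by
        rw [← Finset.mul_sum, ← Finset.mul_sum]
        field_simp

lemma exists_weight_approx {ε δ t : ℝ} (hε : 0 < ε) (hδ : 0 < δ) (ht : 0 < t)
    (hhouse : ∀ (W : Type) [Fintype W] (H : SimpleGraph W),
      HouseFree H → 1 < Fintype.card W →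
      (∃ A B : Set W, Disjoint A B ∧ CompleteTo H A B ∧
        ε * δ * (Fintype.card W : ℝ) ≤ (A.ncard : ℝ) ∧
        ε * δ * (Fintype.card W : ℝ) ≤ (B.ncard : ℝ)) ∨
      (∃ X : Set W, δ * (Fintype.card W : ℝ) ≤ (X.ncard : ℝ) ∧
        ∀ v ∈ X, ((H.neighborSet v ∩ X).ncard : ℝ) < ε * (X.ncard : ℝ)))
    {V : Type} [Fintype V] {G : SimpleGraph V} (hG : HouseFree G) {x : V → ℝ} (hx : ∀ v, 0 ≤ x v)
    (hpair : ∀ A B : Finset V, Disjoint A B → CompleteTo G (A : Set V) (B : Set V) →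
      t * ∑ v ∈ A, x v ≤ 1 ∨ t * ∑ v ∈ B, x v ≤ 1)
    {K N : ℕ} (hK : 2 ≤ K) (hN : 0 < N)
    (hlarge : 1 < t * (ε * δ * (∑ v, x v - Fintype.card V / N) - (∑ v, x v) / K)) :
    ∃ y : V → ℝ, (∀ v, 0 ≤ y v ∧ y v ≤ x v) ∧
      δ * (∑ v, x v - Fintype.card V / N) ≤ ∑ v, y v ∧
      ∀ v, 0 < y v → ∑ u with G.Adj v u, y u + y v / K ≤ ε * ∑ v, y v + 1 / N := by
  have hK0 : (0 : ℝ) < K := by positivity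
  have hN0 : (0 : ℝ) < N := by positivity
  have hx0 : 0 ≤ ∑ v, x v := Finset.sum_nonneg fun v _ => hx v
  set n : V → ℕ := fun v => ⌊N * x v⌋₊ with hn
  have hcard : Fintype.card (Σ v, Fin (n v) × Fin K) = (∑ v, n v) * K := by
    simp [Fintype.card_sigma, Finset.sum_mul]
  have hlower : N * K * (∑ v, x v - Fintype.card V / N) ≤
      (Fintype.card (Σ v, Fin (n v) × Fin K) : ℝ) := by
    have h : ∑ v, (N * x v - 1) ≤ ∑ v, (n v : ℝ) := Finset.sum_le_sum fun v _ =>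
      (Nat.sub_one_lt_floor _).le
    rw [Finset.sum_sub_distrib, ← Finset.mul_sum] at h
    simp only [Finset.sum_const, Finset.card_univ, nsmul_eq_mul, mul_one] at h
    rw [hcard]
    push_cast
    calc _ = (N * ∑ v, x v - Fintype.card V) * K := by field_simp
      _ ≤ _ := by gcongr
  have hmain : 0 < ε * δ * (∑ v, x v - Fintype.card V / N) - (∑ v, x v) / K :=
    pos_of_mul_pos_right (one_pos.trans hlarge) ht.le
  have hpos : 0 < ∑ v, x v - Fintype.card V / N := by
    have h1 : 0 ≤ (∑ v, x v) / K := by positivity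
    exact pos_of_mul_pos_right (a := ε * δ) (by linarith) (by positivity)
  have hone : 1 < Fintype.card (Σ v, Fin (n v) × Fin K) := by
    have h : (0 : ℝ) < (Fintype.card (Σ v, Fin (n v) × Fin K) : ℝ) :=
      lt_of_lt_of_le (by positivity) hlower
    rw [hcard] at h ⊢
    have : 0 < ∑ v, n v := Nat.pos_of_mul_pos_right (Nat.cast_pos.1 h)
    nlinarith
  rcases hhouse _ (blowup G n K) (hG.blowup n K) hone with
    ⟨A, B, -, hcomp, hA, hB⟩ | ⟨X, hX, hdeg⟩
  · exfalso
    rw [Set.ncard_eq_toFinset_card'] at hA hB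
    have hcomp' : CompleteTo (blowup G n K) (A.toFinset : Set _) (B.toFinset : Set _) := by
      simpa using hcomp
    have hcomp'' : CompleteTo (blowup G n K) (B.toFinset : Set _) (A.toFinset : Set _) :=
      fun b hb a ha => (hcomp' a ha b hb).symm
    have key : ∀ C : Finset (Σ v, Fin (n v) × Fin K), ∀ s : ℝ,
        ε * δ * (Fintype.card (Σ v, Fin (n v) × Fin K) : ℝ) ≤ #C →
        (#C : ℝ) ≤ N * K * (s + (∑ v, x v) / K) → 1 < t * s := by
      intro C s h1 h2
      refine hlarge.trans_le (mul_le_mul_of_nonneg_left ?_ ht.le)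
      have h3 := mul_le_mul_of_nonneg_left hlower (mul_nonneg hε.le hδ.le)
      have h4 : N * K * (ε * δ * (∑ v, x v - Fintype.card V / N)) ≤
          N * K * (s + (∑ v, x v) / K) := by linarith
      have := le_of_mul_le_mul_left h4 (by positivity)
      linarith
    have hAs := key _ _ hA (card_cast_le_of_completeTo_blowup (by omega) hN hx hcomp')
    have hBs := key _ _ hB (card_cast_le_of_completeTo_blowup (by omega) hN hx hcomp'')
    rcases hpair _ _ (Finset.disjoint_left.2 fun v hv hv' =>
      (Finset.mem_sdiff.1 hv').2 (Finset.mem_sdiff.1 hv).1)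
      (completeTo_sdiff_image_fst hcomp') with h | h <;> linarith
  · set S := X.toFinset with hS
    have hXS : X.ncard = #S := Set.ncard_eq_toFinset_card' X
    rw [hXS] at hX
    refine ⟨fun v => #{a ∈ S | a.1 = v} / (N * K), fun v => ⟨by positivity, ?_⟩, ?_, ?_⟩
    · rw [div_le_iff₀ (by positivity)]
      have h1 : (#{a ∈ S | a.1 = v} : ℝ) ≤ n v * K := by exact_mod_cast card_filter_fst_le S v
      have h2 : (n v : ℝ) ≤ N * x v := Nat.floor_le (mul_nonneg N.cast_nonneg (hx v))
      nlinarith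
    all_goals
      have hsum : ∑ v, (#{a ∈ S | a.1 = v} : ℝ) / (N * K) = #S / (N * K) := by
        rw [← Finset.sum_div]
        congr 1
        exact_mod_cast (card_eq_sum_card_filter_fst S).symm
    · rw [hsum, le_div_iff₀ (by positivity)]
      have := mul_le_mul_of_nonneg_left hlower hδ.le
      linarith
    · intro v hv
      have hv' : 0 < #{a ∈ S | a.1 = v} := by
        have h := (div_pos_iff_of_pos_right (by positivity)).1 hv
        exact_mod_cast h
      obtain ⟨w, hw, hle⟩ := exists_mul_sum_le_degree (G := G) hv'
      have hdw := hdeg w (Set.mem_toFinset.1 hw)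
      have hnbr : ((blowup G n K).neighborSet w ∩ X).ncard =
          #{a ∈ S | (blowup G n K).Adj w a} := by
        rw [← Set.ncard_coe_finset]
        congr 1
        ext a
        simp [hS, and_comm]
      rw [hnbr, hXS] at hdw
      have hle' : (K : ℝ) * ∑ u with G.Adj v u, (#{a ∈ S | a.1 = u} : ℝ) +
          #{a ∈ S | a.1 = v} ≤ K * (#{a ∈ S | (blowup G n K).Adj w a} + 1) := by
        exact_mod_cast hle
      rw [hsum, ← Finset.sum_div]
      have hKone : (1 : ℝ) ≤ K := by exact_mod_cast (by omega : 1 ≤ K)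
      have hle2 : (K : ℝ) * ∑ u with G.Adj v u, (#{a ∈ S | a.1 = u} : ℝ) +
          #{a ∈ S | a.1 = v} ≤ K * (ε * #S + K) :=
        hle'.trans (mul_le_mul_of_nonneg_left (by linarith) hK0.le)
      calc _ = ((K : ℝ) * ∑ u with G.Adj v u, (#{a ∈ S | a.1 = u} : ℝ) +
            #{a ∈ S | a.1 = v}) / (N * K * K) := by field_simp
        _ ≤ (K * (ε * #S + K)) / (N * K * K) := by gcongr
        _ = _ := by field_simp

lemma exists_weight {ε δ t : ℝ} (hε : 0 < ε) (hδ : 0 < δ) (ht : 1 < ε * δ * t)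
    (hhouse : ∀ (W : Type) [Fintype W] (H : SimpleGraph W),
      HouseFree H → 1 < Fintype.card W →
      (∃ A B : Set W, Disjoint A B ∧ CompleteTo H A B ∧
        ε * δ * (Fintype.card W : ℝ) ≤ (A.ncard : ℝ) ∧
        ε * δ * (Fintype.card W : ℝ) ≤ (B.ncard : ℝ)) ∨
      (∃ X : Set W, δ * (Fintype.card W : ℝ) ≤ (X.ncard : ℝ) ∧
        ∀ v ∈ X, ((H.neighborSet v ∩ X).ncard : ℝ) < ε * (X.ncard : ℝ)))
    {V : Type} [Fintype V] {G : SimpleGraph V} (hG : HouseFree G) {x : V → ℝ} (hx : ∀ v, 0 ≤ x v)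
    (hpair : ∀ A B : Finset V, Disjoint A B → CompleteTo G (A : Set V) (B : Set V) →
      t * ∑ v ∈ A, x v ≤ 1 ∨ t * ∑ v ∈ B, x v ≤ 1)
    (hsum : 1 < ∑ v, x v) :
    ∃ y : V → ℝ, (∀ v, 0 ≤ y v ∧ y v ≤ x v) ∧ δ * ∑ v, x v ≤ ∑ v, y v ∧
      ∀ v, 0 < y v → ∑ u with G.Adj v u, y u < ε * ∑ v, y v := by
  have ht0 : 0 < t := pos_of_mul_pos_right (one_pos.trans ht) (by positivity)
  have hlim : 1 < t * (ε * δ * ∑ v, x v) := by nlinarith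
  have hinv : ∀ c : ℝ, Tendsto (fun m : ℕ => c / m) atTop (𝓝 0) :=
    tendsto_const_div_atTop_nhds_zero_nat
  obtain ⟨K, hKlarge, hK⟩ : ∃ K : ℕ,
      1 < t * (ε * δ * ∑ v, x v - (∑ v, x v) / K) ∧ 2 ≤ K := by
    have h : Tendsto (fun K : ℕ => t * (ε * δ * ∑ v, x v - (∑ v, x v) / K)) atTop
        (𝓝 (t * (ε * δ * ∑ v, x v - 0))) := (tendsto_const_nhds.sub (hinv _)).const_mul t
    rw [sub_zero] at h
    exact ((h.eventually_const_lt hlim).and (eventually_ge_atTop 2)).exists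
  have hNlarge : ∀ᶠ N : ℕ in atTop,
      1 < t * (ε * δ * (∑ v, x v - Fintype.card V / N) - (∑ v, x v) / K) := by
    have h : Tendsto (fun N : ℕ => t * (ε * δ * (∑ v, x v - Fintype.card V / N) -
        (∑ v, x v) / K)) atTop (𝓝 (t * (ε * δ * (∑ v, x v - 0) - (∑ v, x v) / K))) :=
      (((tendsto_const_nhds.sub (hinv _)).const_mul _).sub tendsto_const_nhds).const_mul t
    rw [sub_zero] at h
    exact h.eventually_const_lt hKlarge
  obtain ⟨N₀, hN₀⟩ := eventually_atTop.1 (hNlarge.and (eventually_gt_atTop 0))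
  choose y hyx hysum hydeg using fun m : ℕ =>
    exists_weight_approx hε hδ ht0 hhouse hG hx hpair hK (hN₀ (m + N₀) (by omega)).2
      (hN₀ (m + N₀) (by omega)).1
  have hcompact : IsCompact (Set.univ.pi fun v => Set.Icc 0 (x v)) :=
    isCompact_univ_pi fun v => isCompact_Icc
  obtain ⟨z, hz, φ, hφ, hlimz⟩ := hcompact.tendsto_subseq fun m =>
    (fun v _ => hyx m v : y m ∈ Set.univ.pi fun v => Set.Icc 0 (x v))
  have hcoord : ∀ v, Tendsto (fun m => y (φ m) v) atTop (𝓝 (z v)) := fun v =>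
    (tendsto_pi_nhds.1 hlimz) v
  have hsumlim : ∀ s : Finset V, Tendsto (fun m => ∑ v ∈ s, y (φ m) v) atTop
      (𝓝 (∑ v ∈ s, z v)) := fun s => tendsto_finsetSum _ fun v _ => hcoord v
  have hshift : Tendsto (fun m => φ m + N₀) atTop atTop :=
    tendsto_atTop_mono (fun m => Nat.le_add_right _ _) hφ.tendsto_atTop
  have hinv' : ∀ c : ℝ, Tendsto (fun m : ℕ => c / ((φ m + N₀ : ℕ) : ℝ)) atTop (𝓝 0) := fun c =>
    (hinv c).comp hshift
  refine ⟨z, fun v => hz v (Set.mem_univ v), ?_, fun v hv => ?_⟩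
  · have h := (tendsto_const_nhds (x := ∑ v, x v)).sub (hinv' (Fintype.card V)) |>.const_mul δ
    rw [sub_zero] at h
    exact le_of_tendsto_of_tendsto' h (hsumlim univ) fun m => hysum (φ m)
  · have hle : ∑ u with G.Adj v u, z u + z v / K ≤ ε * ∑ v, z v + 0 := by
      refine le_of_tendsto_of_tendsto ((hsumlim _).add ((hcoord v).div_const K))
        (((hsumlim univ).const_mul ε).add (hinv' 1)) ?_
      filter_upwards [(hcoord v).eventually_const_lt hv] with m hm
      exact hydeg (φ m) v hm
    have : 0 < z v / K := by positivity
    linarith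

end Weight

theorem statement_18 (ε δ : ℝ) (hε : 0 < ε) (hδ : 0 < δ)
    (hhouse : ∀ (W : Type) [Fintype W] (H : SimpleGraph W),
      HouseFree H → 1 < Fintype.card W →
      (∃ A B : Set W, Disjoint A B ∧ CompleteTo H A B ∧
        ε * δ * (Fintype.card W : ℝ) ≤ (A.ncard : ℝ) ∧
        ε * δ * (Fintype.card W : ℝ) ≤ (B.ncard : ℝ)) ∨
      (∃ X : Set W, δ * (Fintype.card W : ℝ) ≤ (X.ncard : ℝ) ∧
        ∀ v ∈ X, ((H.neighborSet v ∩ X).ncard : ℝ) < ε * (X.ncard : ℝ)))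
    (α : ℝ) (hα : 1 ≤ α) (hεδ : 1 < ε * δ * (2 : ℝ) ^ α)
    {V : Type} [Fintype V] (G : SimpleGraph V) (f : V → ℝ)
    (hcrit : Critical G f α) (hfree : HouseFree G) :
    ∃ (X : Set V) (g : V → ℝ), GoodOnSub G X g ∧ (∀ v ∈ X, g v ≤ f v) ∧
      δ * ∑ v, f v ^ α ≤ setSum (fun v => g v ^ α) X ∧
      ∀ v ∈ X, setSum (fun u => g u ^ α) (G.neighborSet v ∩ X) <
        ε * setSum (fun v => g v ^ α) X := by
  classical
  have hα0 : α ≠ 0 := by linarith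
  have hf := hcrit.1.1
  obtain ⟨y, hy, hysum, hydeg⟩ := exists_weight hε hδ hεδ hhouse hfree
    (fun v => Real.rpow_nonneg (hf v) α)
    (fun A B hdisj hcomp => hcrit.min_sum_le hdisj hcomp) hcrit.2.2
  have hpow : ∀ v, (y v ^ α⁻¹) ^ α = y v := fun v => Real.rpow_inv_rpow (hy v).1 hα0
  have hnonneg : ∀ v, 0 ≤ y v ^ α⁻¹ := fun v => Real.rpow_nonneg (hy v).1 _
  have hle : ∀ v, y v ^ α⁻¹ ≤ f v := fun v =>
    (Real.rpow_le_rpow (hy v).1 (hy v).2 (by positivity)).trans_eq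
      (Real.rpow_rpow_inv (hf v) hα0)
  have hindicator : ∀ s : Set V, setSum y (s ∩ {v | 0 < y v}) = ∑ v with v ∈ s, y v := by
    intro s
    rw [setSum, Finset.sum_filter]
    refine Finset.sum_congr rfl fun v _ => ?_
    by_cases hs : v ∈ s
    · rcases (hy v).1.lt_or_eq with h | h
      · simp [hs, h]
      · simp [← h]
    · simp [hs]
  have hX : setSum y {v | 0 < y v} = ∑ v, y v := by
    simpa using hindicator Set.univ
  refine ⟨{v | 0 < y v}, fun v => y v ^ α⁻¹, ⟨fun v _ => hnonneg v, fun S _ hS => ?_⟩,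
    fun v _ => hle v, ?_, fun v hv => ?_⟩
  · exact (Finset.sum_le_sum fun v _ => hle v).trans (hcrit.1.2 S hS)
  · simp only [hpow]
    rw [hX]
    exact hysum
  · simp only [hpow]
    rw [hX, hindicator]
    simpa using hydeg v hv

end EHhat
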